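/- Let t > 0 and let (k(n)) be an increasing sequence of positive integers with (n − k(n))/√n → t as n → ∞. For each n let D_i be the number of blocks of size i in a uniformly random set partition of {1,...,n} into exactly k(n) blocks. Then D_3 converges in distribution to a Poisson random variable with mean (2/3)t², and P(D_i = 0 for all i ≥ 4) → 1, i.e. with high probability all blocks other than those of size three have size one or two. -/

import Mathlib

open Finset Filter

/-- Probability of event `E` for a uniformly random set partition of `{1,…,n}` into exactly
`k` blocks (a `Finpartition` of `Finset.univ : Finset (Fin n)` with `k` parts). -/
noncomputable def partProb (n k : ℕ)
    (E : Finpartition (Finset.univ : Finset (Fin n)) → Prop) : ℝ :=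
  (Nat.card {P : Finpartition (Finset.univ : Finset (Fin n)) //
      P.parts.card = k ∧ E P} : ℝ) /
    (Nat.card {P : Finpartition (Finset.univ : Finset (Fin n)) // P.parts.card = k} : ℝ)

/-- `D_i`, the number of blocks of size `i` in a set partition. -/
def blockCount {n : ℕ} (P : Finpartition (Finset.univ : Finset (Fin n))) (i : ℕ) : ℕ :=
  (P.parts.filter fun b => b.card = i).card

theorem card_fun_fibers_eq_multinomial {β : Type*} [Fintype β] [DecidableEq β] (n : ℕ)
    (c : β → ℕ) (hc : ∑ b, c b = n) :
    #{f : Fin n → β | ∀ b, #{a | f a = b} = c b} = Nat.multinomial univ c := by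
  classical
  have h₁ := Fintype.sum_pow (fun b : β => (MvPolynomial.X b : MvPolynomial β ℕ)) n
  rw [Finset.sum_pow_eq_sum_piAntidiag] at h₁
  have h₂ := congrArg (MvPolynomial.coeff (Finsupp.equivFunOnFinite.symm c)) h₁
  have hX (d : β → ℕ) : ∏ b, (MvPolynomial.X b : MvPolynomial β ℕ) ^ d b =
      MvPolynomial.monomial (Finsupp.equivFunOnFinite.symm d) 1 := by
    rw [MvPolynomial.monomial_eq, Finsupp.prod_fintype _ _ (by simp)]
    simp
  have hY (f : Fin n → β) : ∏ a, (MvPolynomial.X (f a) : MvPolynomial β ℕ) =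
      ∏ b, (MvPolynomial.X b : MvPolynomial β ℕ) ^ #{a | f a = b} := by
    rw [← Finset.prod_fiberwise univ f]
    refine prod_congr rfl fun b _ => ?_
    rw [← Finset.prod_const]
    refine prod_congr rfl fun a ha => ?_
    rw [(mem_filter.1 ha).2]
  simp only [hY, hX, MvPolynomial.coeff_sum, MvPolynomial.coeff_monomial,
    EmbeddingLike.apply_eq_iff_eq] at h₂
  rw [Finset.card_filter]
  have h₃ (d : β → ℕ) : MvPolynomial.coeff (Finsupp.equivFunOnFinite.symm c)
      ((Nat.multinomial univ d : MvPolynomial β ℕ) *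
        MvPolynomial.monomial (Finsupp.equivFunOnFinite.symm d) 1) =
      if d = c then Nat.multinomial univ d else 0 := by
    rw [← map_natCast (MvPolynomial.C (σ := β)), MvPolynomial.coeff_C_mul,
      MvPolynomial.coeff_monomial]
    simp
  simp only [h₃] at h₂
  rw [Finset.sum_ite_eq' (piAntidiag univ n) c] at h₂
  rw [if_pos (by simpa using hc)] at h₂
  rw [h₂]
  simp only [funext_iff]

theorem filter_equiv_part_eq {α : Type*} [Fintype α] [DecidableEq α] {ι : Type*} [DecidableEq ι]
    (P : Finpartition (univ : Finset α)) (e : P.parts ≃ ι) (i : ι) :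
    ({a | e ⟨P.part a, P.part_mem.2 (mem_univ a)⟩ = i} : Finset α) = (e.symm i).1 := by
  ext a
  rw [mem_filter_univ, ← P.part_eq_iff_mem (e.symm i).2, ← e.eq_symm_apply, Subtype.ext_iff]

theorem card_finpartition_mul_factorial {n k : ℕ}
    {E : Finpartition (univ : Finset (Fin n)) → Prop} {Q : (Fin k → ℕ) → Prop}
    (hEQ : ∀ (P : Finpartition (univ : Finset (Fin n))) (e : P.parts ≃ Fin k),
      E P ↔ Q fun j => #(e.symm j).1) :
    Nat.card {P : Finpartition (univ : Finset (Fin n)) // P.parts.card = k ∧ E P} * k.factorial =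
      Nat.card {f : Fin n → Fin k // (∀ j, 0 < #{a | f a = j}) ∧ Q fun j => #{a | f a = j}} := by
  classical
  let φ : (Σ P : {P : Finpartition (univ : Finset (Fin n)) // P.parts.card = k ∧ E P},
      (P.1.parts ≃ Fin k)) →
      {f : Fin n → Fin k // (∀ j, 0 < #{a | f a = j}) ∧ Q fun j => #{a | f a = j}} := fun x =>
    ⟨fun a => x.2 ⟨x.1.1.part a, x.1.1.part_mem.2 (mem_univ a)⟩, by
      simp only [filter_equiv_part_eq]
      exact ⟨fun j => card_pos.2 (x.1.1.nonempty_of_mem_parts (x.2.symm j).2),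
        (hEQ x.1.1 x.2).1 x.1.2.2⟩⟩
  have hφ : Function.Bijective φ := by
    constructor
    · rintro ⟨⟨P, hP⟩, e⟩ ⟨⟨P', hP'⟩, e'⟩ h
      have h' (j : Fin k) : (e.symm j).1 = (e'.symm j).1 := by
        rw [← filter_equiv_part_eq, ← filter_equiv_part_eq]
        have := congrArg Subtype.val h
        simp only [φ] at this
        ext a
        simp only [mem_filter_univ]
        rw [congrFun this a]
      have hPP : P = P' := by
        ext s
        constructor
        · intro hs
          have := h' (e ⟨s, hs⟩)
          rw [e.symm_apply_apply] at this
          simp only [] at this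
          rw [this]
          exact (e'.symm _).2
        · intro hs
          have := h' (e' ⟨s, hs⟩)
          rw [e'.symm_apply_apply] at this
          simp only [] at this
          rw [← this]
          exact (e.symm _).2
      subst hPP
      have : e = e' := by
        rw [← Equiv.symm_symm e, ← Equiv.symm_symm e']
        congr 1
        ext j : 2
        exact h' j
      rw [this]
    · rintro ⟨f, hf, hQ⟩
      let P : Finpartition (univ : Finset (Fin n)) :=
        Finpartition.ofExistsUnique (univ.image fun j => ({a | f a = j} : Finset (Fin n))) (by simp)
          (fun a _ => ⟨({b | f b = f a} : Finset (Fin n)), by simp, by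
            rintro s ⟨hs, ha⟩
            obtain ⟨j, -, rfl⟩ := mem_image.1 hs
            rw [mem_filter_univ] at ha
            rw [ha]⟩) (by
            intro h
            obtain ⟨j, -, hj⟩ := mem_image.1 h
            have := hf j
            rw [hj] at this
            simp at this)
      have hmem (j : Fin k) : ({a | f a = j} : Finset (Fin n)) ∈ P.parts :=
        mem_image_of_mem _ (mem_univ j)
      let g : Fin k ≃ P.parts := Equiv.ofBijective
        (fun j => ⟨({a | f a = j} : Finset (Fin n)), hmem j⟩) (by
        constructor
        · intro i j hij
          obtain ⟨a, ha⟩ := card_pos.1 (hf i)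
          have h₁ := ha
          rw [show ({a | f a = i} : Finset (Fin n)) = ({a | f a = j} : Finset (Fin n)) from
            Subtype.ext_iff.1 hij] at h₁
          rw [mem_filter_univ] at ha h₁
          rw [← ha, h₁]
        · rintro ⟨s, hs⟩
          obtain ⟨j, -, rfl⟩ := mem_image.1 hs
          exact ⟨j, rfl⟩)
      refine ⟨⟨⟨P, ?_, (hEQ P g.symm).2 hQ⟩, g.symm⟩, ?_⟩
      · rw [← Fintype.card_coe, ← Fintype.card_congr g, Fintype.card_fin]
      · refine Subtype.ext (funext fun a => ?_)
        simp only [φ]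
        rw [Equiv.symm_apply_eq, Subtype.ext_iff, P.part_eq_iff_mem (g (f a)).2]
        exact mem_filter.2 ⟨mem_univ a, rfl⟩
  rw [← Nat.card_congr (Equiv.ofBijective φ hφ), Nat.card_sigma]
  have (x : {P : Finpartition (univ : Finset (Fin n)) // P.parts.card = k ∧ E P}) :
      Nat.card (x.1.parts ≃ Fin k) = k.factorial := by
    have e : x.1.parts ≃ Fin k := Fintype.equivFinOfCardEq (by simpa using x.2.1)
    rw [Nat.card_eq_fintype_card, Fintype.card_equiv e, Fintype.card_coe, x.2.1]
  rw [sum_congr rfl fun x _ => this x, sum_const, card_univ, Nat.card_eq_fintype_card, smul_eq_mul]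

/-- The weight `∏ i, 1 / (a i + 1)!` of a vector `a` of block sizes in excess of one. -/
noncomputable def blockWeight {k : ℕ} (a : Fin k → ℕ) : ℝ :=
  ∏ i, ((a i + 1).factorial : ℝ)⁻¹

open Classical in
/-- The total weight of the vectors of `k` natural numbers with sum `m` that satisfy `Q`. -/
noncomputable def excessWeight (k m : ℕ) (Q : (Fin k → ℕ) → Prop) : ℝ :=
  ∑ a ∈ piAntidiag (univ : Finset (Fin k)) m with Q a, blockWeight a

theorem card_fun_eq_excessWeight {n k : ℕ} (hkn : k ≤ n) (Q : (Fin k → ℕ) → Prop) :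
    (Nat.card {f : Fin n → Fin k // (∀ j, 0 < #{a | f a = j}) ∧
      Q fun j => #{a | f a = j} - 1} : ℝ) = n.factorial * excessWeight k (n - k) Q := by
  classical
  rw [Nat.card_eq_fintype_card, Fintype.card_subtype]
  have hsum (f : Fin n → Fin k) : ∑ j, #{a | f a = j} = n := by
    rw [← card_eq_sum_card_fiberwise (fun _ _ => mem_coe.2 (mem_univ _)), card_univ,
      Fintype.card_fin]
  rw [card_eq_sum_card_fiberwise (f := fun f j => #{a | f a = j} - 1)
    (t := {a ∈ piAntidiag (univ : Finset (Fin k)) (n - k) | Q a}), excessWeight, Nat.cast_sum,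
    mul_sum]
  · refine sum_congr rfl fun a ha => ?_
    rw [mem_filter, mem_piAntidiag] at ha
    have hset : ({f ∈ {f : Fin n → Fin k | (∀ j, 0 < #{a | f a = j}) ∧
        Q fun j => #{a | f a = j} - 1} | (fun j => #{a | f a = j} - 1) = a} :
        Finset (Fin n → Fin k)) = ({f | ∀ j, #{x | f x = j} = a j + 1} : Finset _) := by
      ext f
      simp only [mem_filter, mem_univ, true_and]
      constructor
      · rintro ⟨⟨hf, -⟩, rfl⟩ j
        exact (Nat.sub_add_cancel (hf j)).symm
      · intro h
        simp [h, ha.2]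
    have hs : ∑ j, (a j + 1) = n := by
      rw [sum_add_distrib, ha.1.1]
      simp [hkn]
    have hcard : #({f | ∀ j, #{x | f x = j} = a j + 1} : Finset (Fin n → Fin k)) =
        Nat.multinomial univ fun j => a j + 1 := by
      convert card_fun_fibers_eq_multinomial n (fun j => a j + 1) hs
    rw [hset, hcard, blockWeight,
      prod_inv_distrib, ← div_eq_mul_inv, eq_div_iff (by positivity)]
    have := Nat.multinomial_spec univ fun j => a j + 1
    rw [hs, mul_comm] at this
    exact_mod_cast this
  · intro f hf
    simp only [coe_filter, mem_univ, true_and, Set.mem_ofPred_eq, mem_piAntidiag] at hf ⊢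
    refine ⟨⟨?_, by simp⟩, hf.2⟩
    zify [hkn, fun j => hf.1 j]
    rw [sum_sub_distrib, ← Nat.cast_sum, hsum]
    simp

theorem partProb_eq_excessWeight_div {n k : ℕ} (hkn : k ≤ n)
    {E : Finpartition (univ : Finset (Fin n)) → Prop} {Q : (Fin k → ℕ) → Prop}
    (hEQ : ∀ (P : Finpartition (univ : Finset (Fin n))) (e : P.parts ≃ Fin k),
      E P ↔ Q fun j => #(e.symm j).1 - 1) :
    partProb n k E = excessWeight k (n - k) Q / excessWeight k (n - k) fun _ => True := by
  have h₁ := card_finpartition_mul_factorial (Q := fun c => Q fun j => c j - 1) hEQ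
  have h₂ := card_finpartition_mul_factorial (n := n) (k := k) (E := fun _ => True)
    (Q := fun _ => True) (by simp)
  replace h₁ := congrArg (Nat.cast (R := ℝ)) h₁
  replace h₂ := congrArg (Nat.cast (R := ℝ)) h₂
  rw [card_fun_eq_excessWeight hkn Q, Nat.cast_mul] at h₁
  rw [card_fun_eq_excessWeight hkn fun _ => True, Nat.cast_mul] at h₂
  simp only [and_true] at h₂
  have hk : (k.factorial : ℝ) ≠ 0 := by positivity
  have hn : (n.factorial : ℝ) ≠ 0 := by positivity
  rw [partProb, ← mul_div_mul_right _ _ hk, h₁, h₂, mul_div_mul_left _ _ hn]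

theorem card_filter_equiv_parts {n k : ℕ} (P : Finpartition (univ : Finset (Fin n)))
    (e : P.parts ≃ Fin k) (i : ℕ) :
    #{j | #(e.symm j).1 - 1 = i} = blockCount P (i + 1) := by
  refine card_bij (fun j _ => (e.symm j).1) (fun j hj => ?_) (fun i _ j _ h => ?_) fun b hb => ?_
  · rw [mem_filter_univ] at hj
    have := card_pos.2 (P.nonempty_of_mem_parts (e.symm j).2)
    exact mem_filter.2 ⟨(e.symm j).2, by omega⟩
  · exact e.symm.injective (Subtype.ext h)
  · rw [mem_filter] at hb
    exact ⟨e ⟨b, hb.1⟩, by simp [hb.2], by simp⟩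

theorem sum_update_add {k : ℕ} (a : Fin k → ℕ) (i : Fin k) (v : ℕ) :
    univ.sum (Function.update a i v) + a i = univ.sum a + v := by
  rw [sum_update_of_mem (mem_univ i), ← add_sum_erase univ a (mem_univ i), sdiff_singleton_eq_erase]
  ring

theorem blockWeight_pos {k : ℕ} (a : Fin k → ℕ) : 0 < blockWeight a :=
  prod_pos fun _ _ => by positivity

theorem blockWeight_update_mul {k : ℕ} (a : Fin k → ℕ) (i : Fin k) (v : ℕ) :
    blockWeight (Function.update a i v) * (v + 1).factorial =
      blockWeight a * (a i + 1).factorial := by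
  have h (b : Fin k → ℕ) : blockWeight b * (b i + 1).factorial =
      ∏ j ∈ univ.erase i, ((b j + 1).factorial : ℝ)⁻¹ := by
    rw [blockWeight, ← mul_prod_erase univ _ (mem_univ i)]
    field_simp
  have h' := h (Function.update a i v)
  rw [Function.update_self] at h'
  rw [h', h]
  exact prod_congr rfl fun j hj => by rw [Function.update_of_ne (ne_of_mem_erase hj)]

theorem excessWeight_nonneg {k m : ℕ} (Q : (Fin k → ℕ) → Prop) : 0 ≤ excessWeight k m Q :=
  sum_nonneg fun a _ => (blockWeight_pos a).le

theorem excessWeight_mono {k m : ℕ} {Q R : (Fin k → ℕ) → Prop} (h : ∀ a, Q a → R a) :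
    excessWeight k m Q ≤ excessWeight k m R := by
  classical
  exact sum_le_sum_of_subset_of_nonneg (monotone_filter_right _ fun a _ => h a)
    fun a _ _ => (blockWeight_pos a).le

theorem excessWeight_or_le {k m : ℕ} (Q R : (Fin k → ℕ) → Prop) :
    excessWeight k m (fun a => Q a ∨ R a) ≤ excessWeight k m Q + excessWeight k m R := by
  classical
  simp only [excessWeight, sum_filter, ← sum_add_distrib]
  refine sum_le_sum fun a _ => ?_
  have := (blockWeight_pos a).le
  split_ifs <;> simp_all

theorem excessWeight_add_not {k m : ℕ} (Q : (Fin k → ℕ) → Prop) :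
    excessWeight k m Q + excessWeight k m (fun a => ¬ Q a) = excessWeight k m fun _ => True := by
  classical
  simp only [excessWeight]
  rw [sum_filter_add_sum_filter_not, filter_true]

theorem excessWeight_true_pos {k : ℕ} (hk : 0 < k) (m : ℕ) :
    0 < excessWeight k m fun _ => True := by
  refine sum_pos (fun a _ => blockWeight_pos a) ⟨Pi.single ⟨0, hk⟩ m, ?_⟩
  simp

/-- Switching: raising a zero entry to one. -/
theorem mul_excessWeight_le_succ {k m : ℕ} (hmk : m ≤ k) :
    ((k - m : ℕ) : ℝ) * excessWeight k m (fun _ => True) ≤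
      2 * (m + 1) * excessWeight k (m + 1) fun _ => True := by
  simp only [excessWeight, filter_true, mul_sum]
  calc ∑ a ∈ piAntidiag univ m, ((k - m : ℕ) : ℝ) * blockWeight a
      ≤ ∑ a ∈ piAntidiag (univ : Finset (Fin k)) m, ∑ i with a i = 0, blockWeight a := by
        refine sum_le_sum fun a ha => ?_
        rw [sum_const, nsmul_eq_mul]
        refine mul_le_mul_of_nonneg_right (Nat.cast_le.2 ?_) (blockWeight_pos a).le
        rw [mem_piAntidiag] at ha
        have h₁ : #{i | ¬ a i = 0} ≤ m := by
          rw [← ha.1, card_filter]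
          exact sum_le_sum fun i _ => by split_ifs <;> omega
        have h₂ := card_filter_add_card_filter_not (s := (univ : Finset (Fin k))) fun i => a i = 0
        rw [card_univ, Fintype.card_fin] at h₂
        omega
    _ = ∑ b ∈ piAntidiag (univ : Finset (Fin k)) (m + 1), ∑ i with b i = 1,
          2 * blockWeight b := by
        rw [sum_sigma', sum_sigma']
        refine sum_bij' (fun x _ => ⟨Function.update x.1 x.2 1, x.2⟩)
          (fun x _ => ⟨Function.update x.1 x.2 0, x.2⟩) ?_ ?_ ?_ ?_ ?_
        · rintro ⟨a, i⟩ h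
          simp only [mem_sigma, mem_piAntidiag, mem_filter_univ] at h ⊢
          have := sum_update_add a i 1
          simp only [mem_univ, implies_true, and_true, Function.update_self] at h ⊢
          omega
        · rintro ⟨a, i⟩ h
          simp only [mem_sigma, mem_piAntidiag, mem_filter_univ] at h ⊢
          have := sum_update_add a i 0
          simp only [mem_univ, implies_true, and_true, Function.update_self] at h ⊢
          omega
        · rintro ⟨a, i⟩ h
          simp only [mem_sigma, mem_filter_univ] at h
          simp [← h.2]
        · rintro ⟨a, i⟩ h
          simp only [mem_sigma, mem_filter_univ] at h
          simp [← h.2]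
        · rintro ⟨a, i⟩ h
          simp only [mem_sigma, mem_filter_univ] at h
          have := blockWeight_update_mul a i 1
          rw [h.2] at this
          norm_num at this
          linarith
    _ ≤ ∑ b ∈ piAntidiag (univ : Finset (Fin k)) (m + 1), 2 * (m + 1) * blockWeight b := by
        refine sum_le_sum fun b hb => ?_
        rw [sum_const, nsmul_eq_mul]
        rw [mem_piAntidiag] at hb
        have h₁ : #{i | b i = 1} ≤ m + 1 := by
          rw [← hb.1, card_filter]
          exact sum_le_sum fun i _ => by split_ifs <;> omega
        have h₂ : (#{i | b i = 1} : ℝ) ≤ m + 1 := by exact_mod_cast h₁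
        nlinarith [blockWeight_pos b]

theorem excessWeight_le_mul_succ {k l m : ℕ} (hlm : l + 1 ≤ m) (hmk : m < k) :
    excessWeight k l (fun _ => True) ≤
      2 * m / ((k - m : ℕ) : ℝ) * excessWeight k (l + 1) fun _ => True := by
  have hpos : (0 : ℝ) < (k - m : ℕ) := by exact_mod_cast Nat.sub_pos_of_lt hmk
  have h₀ := excessWeight_nonneg (m := l) fun _ : Fin k → ℕ => True
  have h₁ := excessWeight_nonneg (m := l + 1) fun _ : Fin k → ℕ => True
  rw [div_mul_eq_mul_div, le_div_iff₀ hpos, mul_comm]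
  refine (mul_le_mul_of_nonneg_right ?_ h₀).trans
    ((mul_excessWeight_le_succ (k := k) (m := l) (by omega)).trans
      (mul_le_mul_of_nonneg_right ?_ h₁))
  · exact_mod_cast (by omega : k - m ≤ k - l)
  · have : ((l + 1 : ℕ) : ℝ) ≤ m := by exact_mod_cast hlm
    push_cast at this
    linarith

/-- Switching: lowering an entry that is at least three by three. -/
theorem excessWeight_exists_three_le_le (k l : ℕ) :
    excessWeight k (l + 3) (fun a => ∃ i, 3 ≤ a i) ≤ k * excessWeight k l fun _ => True := by
  classical
  have hle (i : Fin k) : excessWeight k (l + 3) (fun a => 3 ≤ a i) ≤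
      excessWeight k l fun _ => True := by
    simp only [excessWeight, filter_true]
    calc ∑ a ∈ piAntidiag univ (l + 3) with 3 ≤ a i, blockWeight a
        ≤ ∑ a ∈ piAntidiag (univ : Finset (Fin k)) (l + 3) with 3 ≤ a i,
            blockWeight (Function.update a i (a i - 3)) := by
          refine sum_le_sum fun a _ => ?_
          have h := blockWeight_update_mul a i (a i - 3)
          have hf : ((a i - 3 + 1).factorial : ℝ) ≤ (a i + 1).factorial := by
            exact_mod_cast Nat.factorial_le (by omega)
          have h₀ : (0 : ℝ) < (a i - 3 + 1).factorial := by positivity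
          refine le_of_mul_le_mul_right ?_ h₀
          rw [h]
          exact mul_le_mul_of_nonneg_left hf (blockWeight_pos a).le
      _ = ∑ b ∈ ({a ∈ piAntidiag univ (l + 3) | 3 ≤ a i} : Finset (Fin k → ℕ)).image
            fun a => Function.update a i (a i - 3), blockWeight b := by
          rw [sum_image]
          intro a ha b hb hab
          simp only [coe_filter, Set.mem_ofPred_eq] at ha hb
          ext j
          have := congrFun hab j
          by_cases hj : j = i
          · subst hj
            simp only [Function.update_self] at this
            omega
          · simpa [hj] using this
      _ ≤ ∑ b ∈ piAntidiag univ l, blockWeight b := by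
          refine sum_le_sum_of_subset_of_nonneg (fun b hb => ?_)
            fun b _ _ => (blockWeight_pos b).le
          obtain ⟨a, ha, rfl⟩ := mem_image.1 hb
          simp only [mem_filter, mem_piAntidiag, mem_univ, implies_true, and_true] at ha ⊢
          have := sum_update_add a i (a i - 3)
          omega
  calc excessWeight k (l + 3) (fun a => ∃ i, 3 ≤ a i)
      ≤ ∑ i : Fin k, excessWeight k (l + 3) fun a => 3 ≤ a i := by
        simp only [excessWeight, sum_filter]
        rw [sum_comm]
        refine sum_le_sum fun a _ => ?_
        have hn (i : Fin k) : 0 ≤ if 3 ≤ a i then blockWeight a else 0 := by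
          split_ifs
          exacts [(blockWeight_pos a).le, le_rfl]
        split_ifs with h
        · obtain ⟨i, hi⟩ := h
          refine le_trans ?_ (single_le_sum (fun i _ => hn i) (mem_univ i))
          rw [if_pos hi]
        · exact sum_nonneg fun i _ => hn i
    _ ≤ ∑ _i : Fin k, excessWeight k l fun _ => True := sum_le_sum fun i _ => hle i
    _ = k * excessWeight k l fun _ => True := by simp

theorem excessWeight_exists_three_le_le_mul {k m : ℕ} (hmk : m < k) :
    excessWeight k m (fun a => ∃ i, 3 ≤ a i) ≤
      k * (2 * m / ((k - m : ℕ) : ℝ)) ^ 3 * excessWeight k m fun _ => True := by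
  classical
  have h₀ := excessWeight_nonneg (m := m) fun _ : Fin k → ℕ => True
  have hr : 0 ≤ 2 * m / ((k - m : ℕ) : ℝ) := by positivity
  rcases lt_or_ge m 3 with hm | hm
  · have : excessWeight k m (fun a => ∃ i, 3 ≤ a i) = 0 := by
      refine sum_eq_zero fun a ha => absurd ha ?_
      simp only [mem_filter, mem_piAntidiag]
      rintro ⟨⟨hs, -⟩, i, hi⟩
      have : a i ≤ univ.sum a := single_le_sum (fun _ _ => Nat.zero_le _) (mem_univ i)
      omega
    rw [this]
    positivity
  · obtain ⟨l, rfl⟩ := Nat.exists_eq_add_of_le' hm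
    refine (excessWeight_exists_three_le_le k l).trans ?_
    have h₁ := excessWeight_le_mul_succ (k := k) (l := l) (m := l + 3) (by omega) hmk
    have h₂ := excessWeight_le_mul_succ (k := k) (l := l + 1) (m := l + 3) (by omega) hmk
    have h₃ := excessWeight_le_mul_succ (k := k) (l := l + 2) (m := l + 3) (by omega) hmk
    rw [mul_assoc]
    refine mul_le_mul_of_nonneg_left ?_ (by positivity)
    refine h₁.trans ?_
    rw [pow_succ', pow_two, mul_assoc, mul_assoc]
    exact mul_le_mul_of_nonneg_left (h₂.trans (mul_le_mul_of_nonneg_left h₃ hr)) hr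

/-- Switching: replacing an entry two and an entry zero by two entries one. -/
theorem excessWeight_card_two_succ (k m j : ℕ) (hmk : m ≤ k) :
    ((j + 1) * ((k - m : ℕ) + j + 1) : ℝ) *
        excessWeight k m (fun a => (∀ i, a i ≤ 2) ∧ #{i | a i = 2} = j + 1) =
      2 / 3 * ((m - 2 * j : ℕ) * (m - 2 * j - 1 : ℕ)) *
        excessWeight k m fun a => (∀ i, a i ≤ 2) ∧ #{i | a i = 2} = j := by
  classical
  have hcount (a : Fin k → ℕ) (ha : univ.sum a = m) (h2 : ∀ i, a i ≤ 2) :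
      #{i | a i = 1} + 2 * #{i | a i = 2} = m ∧
        #{i | a i = 0} + #{i | a i = 1} + #{i | a i = 2} = k := by
    constructor
    · rw [← ha, card_filter, card_filter, mul_sum, ← sum_add_distrib]
      refine sum_congr rfl fun i _ => ?_
      have := h2 i
      split_ifs <;> omega
    · conv_rhs => rw [← Fintype.card_fin k, ← card_univ, card_eq_sum_ones]
      rw [card_filter, card_filter, card_filter, ← sum_add_distrib, ← sum_add_distrib]
      refine sum_congr rfl fun i _ => ?_
      have := h2 i
      split_ifs <;> omega
  have hcard (a : Fin k → ℕ) (i j : Fin k) (u v : ℕ) (hij : i ≠ j) :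
      #{l | Function.update (Function.update a i u) j v l = 2} +
        ((if a i = 2 then 1 else 0) + if a j = 2 then 1 else 0) = #{l | a l = 2} +
        ((if u = 2 then 1 else 0) + if v = 2 then 1 else 0) := by
    rw [card_filter, card_filter, ← add_sum_erase univ _ (mem_univ j),
      ← add_sum_erase univ (fun l => if a l = 2 then 1 else 0) (mem_univ j),
      ← add_sum_erase _ _ (mem_erase.2 ⟨hij, mem_univ i⟩),
      ← add_sum_erase _ (fun l => if a l = 2 then 1 else 0) (mem_erase.2 ⟨hij, mem_univ i⟩),
      Function.update_self, Function.update_of_ne hij, Function.update_self]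
    have : ∑ l ∈ (univ.erase j).erase i,
        (if Function.update (Function.update a i u) j v l = 2 then 1 else 0) =
        ∑ l ∈ (univ.erase j).erase i, if a l = 2 then 1 else 0 := by
      refine sum_congr rfl fun l hl => ?_
      rw [mem_erase, mem_erase] at hl
      rw [Function.update_of_ne hl.2.1, Function.update_of_ne hl.1]
    rw [this]
    ring
  have hsum (a : Fin k → ℕ) (i j : Fin k) (u v : ℕ) (hij : i ≠ j) :
      univ.sum (Function.update (Function.update a i u) j v) + (a i + a j) =
        univ.sum a + (u + v) := by
    have h₁ := sum_update_add a i u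
    have h₂ := sum_update_add (Function.update a i u) j v
    rw [Function.update_of_ne hij.symm] at h₂
    omega
  have hle (a : Fin k → ℕ) (i j : Fin k) (u v : ℕ) (hu : u ≤ 2) (hv : v ≤ 2)
      (ha : ∀ l, a l ≤ 2) (l : Fin k) :
      Function.update (Function.update a i u) j v l ≤ 2 := by
    simp only [Function.update_apply]
    split_ifs
    exacts [hv, hu, ha l]
  have hback (a : Fin k → ℕ) (i j : Fin k) (u v : ℕ) (hij : i ≠ j) :
      Function.update (Function.update (Function.update (Function.update a i u) j v) i (a i))
        j (a j) = a := by
    ext l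
    simp only [Function.update_apply]
    split_ifs <;> simp_all
  simp only [excessWeight, mul_sum]
  calc ∑ a ∈ piAntidiag (univ : Finset (Fin k)) m with (∀ i, a i ≤ 2) ∧ #{i | a i = 2} = j + 1,
        ((j + 1) * ((k - m : ℕ) + j + 1) : ℝ) * blockWeight a
      = ∑ a ∈ piAntidiag (univ : Finset (Fin k)) m with (∀ i, a i ≤ 2) ∧ #{i | a i = 2} = j + 1,
          ∑ p ∈ ({i | a i = 2} : Finset (Fin k)) ×ˢ ({i | a i = 0} : Finset (Fin k)),
            blockWeight a := by
        refine sum_congr rfl fun a ha => ?_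
        simp only [mem_filter, mem_piAntidiag] at ha
        have := hcount a ha.1.1 ha.2.1
        have h0 : #{i | a i = 0} = k - m + j + 1 := by omega
        rw [sum_const, card_product, ha.2.2, h0, nsmul_eq_mul]
        push_cast
        ring
    _ = ∑ a ∈ piAntidiag (univ : Finset (Fin k)) m with (∀ i, a i ≤ 2) ∧ #{i | a i = 2} = j,
          ∑ p ∈ ({i | a i = 1} : Finset (Fin k)).offDiag, 2 / 3 * blockWeight a := by
        rw [sum_sigma', sum_sigma']
        refine sum_bij'
          (fun x _ => ⟨Function.update (Function.update x.1 x.2.1 1) x.2.2 1, x.2⟩)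
          (fun x _ => ⟨Function.update (Function.update x.1 x.2.1 2) x.2.2 0, x.2⟩) ?_ ?_ ?_ ?_ ?_
        · rintro ⟨a, p, q⟩ h
          simp only [mem_sigma, mem_filter, mem_piAntidiag, mem_product, mem_offDiag, mem_univ,
            true_and, implies_true, and_true] at h ⊢
          obtain ⟨⟨hs, h2, hj⟩, hp, hq⟩ := h
          have hpq : p ≠ q := by rintro rfl; omega
          have h₁ := hsum a p q 1 1 hpq
          have h₂ := hcard a p q 1 1 hpq
          simp only [hp, hq] at h₁ h₂
          norm_num at h₂
          refine ⟨⟨by omega, hle a p q 1 1 (by simp) (by simp) h2, by omega⟩, ?_, by simp, hpq⟩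
          rw [Function.update_of_ne hpq, Function.update_self]
        · rintro ⟨a, p, q⟩ h
          simp only [mem_sigma, mem_filter, mem_piAntidiag, mem_product, mem_offDiag, mem_univ,
            true_and, implies_true, and_true] at h ⊢
          obtain ⟨⟨hs, h2, hj⟩, hp, hq, hpq⟩ := h
          have h₁ := hsum a p q 2 0 hpq
          have h₂ := hcard a p q 2 0 hpq
          simp only [hp, hq] at h₁ h₂
          norm_num at h₂
          refine ⟨⟨by omega, hle a p q 2 0 (by simp) (by simp) h2, by omega⟩, ?_, by simp⟩
          rw [Function.update_of_ne hpq, Function.update_self]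
        · rintro ⟨a, p, q⟩ h
          simp only [mem_sigma, mem_product, mem_filter_univ] at h
          obtain ⟨-, hp, hq⟩ := h
          have hpq : p ≠ q := by rintro rfl; omega
          have := hback a p q 1 1 hpq
          rw [hp, hq] at this
          simp only [this]
        · rintro ⟨a, p, q⟩ h
          simp only [mem_sigma, mem_offDiag, mem_filter_univ] at h
          obtain ⟨-, hp, hq, hpq⟩ := h
          have := hback a p q 2 0 hpq
          rw [hp, hq] at this
          simp only [this]
        · rintro ⟨a, p, q⟩ h
          simp only [mem_sigma, mem_product, mem_filter_univ] at h
          obtain ⟨-, hp, hq⟩ := h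
          have hpq : p ≠ q := by rintro rfl; omega
          have h₁ := blockWeight_update_mul a p 1
          have h₂ := blockWeight_update_mul (Function.update a p 1) q 1
          rw [Function.update_of_ne hpq.symm, hq] at h₂
          rw [hp] at h₁
          norm_num [Nat.factorial] at h₁ h₂
          linarith
    _ = _ := by
        refine sum_congr rfl fun a ha => ?_
        simp only [mem_filter, mem_piAntidiag] at ha
        have := hcount a ha.1.1 ha.2.1
        have h1 : #{i | a i = 1} = m - 2 * j := by omega
        rw [sum_const, offDiag_card, h1, nsmul_eq_mul, ← Nat.mul_sub_one]
        push_cast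
        ring

/-- The ratio of the weight of the vectors with entries at most two and `j` entries two to the
weight of those with entries at most one. -/
noncomputable def twoRatio (k m j : ℕ) : ℝ :=
  ∏ i ∈ range j, 2 / 3 * ((m - 2 * i : ℕ) * (m - 2 * i - 1 : ℕ)) /
    ((i + 1) * ((k - m : ℕ) + i + 1))

theorem excessWeight_card_two_eq {k m : ℕ} (hmk : m ≤ k) (j : ℕ) :
    excessWeight k m (fun a => (∀ i, a i ≤ 2) ∧ #{i | a i = 2} = j) =
      twoRatio k m j * excessWeight k m fun a => (∀ i, a i ≤ 2) ∧ #{i | a i = 2} = 0 := by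
  induction j with
  | zero => simp [twoRatio]
  | succ j ih =>
    have h := excessWeight_card_two_succ k m j hmk
    have h₀ : (0 : ℝ) < (j + 1) * ((k - m : ℕ) + j + 1) := by positivity
    rw [twoRatio, prod_range_succ, ← twoRatio, mul_right_comm, ← ih, mul_div_assoc',
      eq_div_iff h₀.ne', mul_comm, h, mul_comm]

theorem twoRatio_nonneg (k m j : ℕ) : 0 ≤ twoRatio k m j :=
  prod_nonneg fun _ _ => by positivity

theorem twoRatio_eq_zero {k m j : ℕ} (h : m < j) : twoRatio k m j = 0 :=
  prod_eq_zero (mem_range.2 h) (by simp [show m - 2 * m = 0 by omega])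

theorem twoRatio_le {k m : ℕ} (hmk : m < k) (j : ℕ) :
    twoRatio k m j ≤ (2 / 3 * (m : ℝ) ^ 2 / (k - m : ℕ)) ^ j / j.factorial := by
  have hpos : (0 : ℝ) < (k - m : ℕ) := by exact_mod_cast Nat.sub_pos_of_lt hmk
  have h (j : ℕ) : (2 / 3 * (m : ℝ) ^ 2 / (k - m : ℕ)) ^ j / j.factorial =
      ∏ i ∈ range j, 2 / 3 * ((m : ℝ) * m) / ((i + 1) * (k - m : ℕ)) := by
    rw [← prod_range_add_one_eq_factorial, Nat.cast_prod, ← card_range j, ← prod_const,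
      card_range, ← prod_div_distrib]
    refine prod_congr rfl fun i _ => ?_
    push_cast
    field_simp
  rw [h]
  refine prod_le_prod (fun _ _ => by positivity) fun i _ => ?_
  have h₁ : ((m - 2 * i : ℕ) : ℝ) ≤ m := by exact_mod_cast Nat.sub_le _ _
  have h₂ : ((m - 2 * i - 1 : ℕ) : ℝ) ≤ m := by exact_mod_cast by omega
  gcongr
  linarith [(Nat.cast_nonneg i : (0 : ℝ) ≤ i)]

theorem excessWeight_forall_le_two {k m : ℕ} (hmk : m ≤ k) :
    excessWeight k m (fun a => ∀ i, a i ≤ 2) =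
      (excessWeight k m fun a => (∀ i, a i ≤ 2) ∧ #{i | a i = 2} = 0) *
        ∑' j, twoRatio k m j := by
  classical
  rw [tsum_eq_sum (s := range (m + 1)) fun j hj => twoRatio_eq_zero (by simpa using hj), mul_sum]
  simp only [mul_comm _ (twoRatio k m _), ← excessWeight_card_two_eq hmk]
  simp only [excessWeight]
  rw [← sum_fiberwise_of_maps_to (t := range (m + 1)) (g := fun a => #{i | a i = 2})]
  · simp only [filter_filter]
  · intro a ha
    simp only [mem_filter, mem_piAntidiag] at ha
    rw [mem_range, Nat.lt_succ_iff, ← ha.1.1, card_filter]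
    exact sum_le_sum fun i _ => by split_ifs <;> omega

section Asymptotics

variable {t : ℝ} {k m : ℕ → ℕ}

theorem tendsto_inv_sqrt_natCast : Tendsto (fun n : ℕ => (√(n : ℝ))⁻¹) atTop (nhds 0) :=
  tendsto_inv_atTop_zero.comp (Real.tendsto_sqrt_atTop.comp tendsto_natCast_atTop_atTop)

theorem tendsto_div_natCast_zero
    (hm : Tendsto (fun n : ℕ => (m n : ℝ) / √n) atTop (nhds t)) :
    Tendsto (fun n : ℕ => (m n : ℝ) / n) atTop (nhds 0) := by
  have h := hm.mul tendsto_inv_sqrt_natCast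
  rw [mul_zero] at h
  refine h.congr fun n => ?_
  rw [← div_eq_mul_inv, div_div, Real.mul_self_sqrt n.cast_nonneg]

theorem tendsto_atTop_of_div_sqrt (ht : 0 < t)
    (hm : Tendsto (fun n : ℕ => (m n : ℝ) / √n) atTop (nhds t)) : Tendsto m atTop atTop := by
  rw [← tendsto_natCast_atTop_iff (R := ℝ)]
  refine (hm.pos_mul_atTop ht
    (Real.tendsto_sqrt_atTop.comp tendsto_natCast_atTop_atTop)).congr' ?_
  filter_upwards [eventually_gt_atTop 0] with n hn
  have : (0 : ℝ) < n := by exact_mod_cast hn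
  simp only [Function.comp_apply]
  field_simp

theorem tendsto_sub_div_sqrt (ht : 0 < t)
    (hm : Tendsto (fun n : ℕ => (m n : ℝ) / √n) atTop (nhds t)) (c : ℕ) :
    Tendsto (fun n : ℕ => ((m n - c : ℕ) : ℝ) / √n) atTop (nhds t) := by
  have h := hm.sub (tendsto_inv_sqrt_natCast.const_mul (c : ℝ))
  rw [mul_zero, sub_zero] at h
  refine h.congr' ?_
  filter_upwards [(tendsto_atTop_of_div_sqrt ht hm).eventually_ge_atTop c] with n hn
  rw [Nat.cast_sub hn]
  ring

theorem eventually_lt_of_tendsto (hkm : ∀ᶠ n in atTop, k n + m n = n)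
    (hm : Tendsto (fun n : ℕ => (m n : ℝ) / √n) atTop (nhds t)) :
    ∀ᶠ n in atTop, m n < k n := by
  filter_upwards [hkm, (tendsto_div_natCast_zero hm).eventually_lt_const one_half_pos,
    eventually_gt_atTop 0] with n hn h h₀
  have h₀' : (0 : ℝ) < n := by exact_mod_cast h₀
  rw [div_lt_iff₀ h₀'] at h
  have : (2 * m n : ℝ) < n := by linarith
  have : 2 * m n < n := by exact_mod_cast this
  omega

theorem tendsto_div_natCast_one (hkm : ∀ᶠ n in atTop, k n + m n = n)
    (hm : Tendsto (fun n : ℕ => (m n : ℝ) / √n) atTop (nhds t)) :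
    Tendsto (fun n : ℕ => (k n : ℝ) / n) atTop (nhds 1) := by
  have h := (tendsto_div_natCast_zero hm).const_sub 1
  rw [sub_zero] at h
  refine h.congr' ?_
  filter_upwards [hkm, eventually_gt_atTop 0] with n hn h₀
  have h₀' : (n : ℝ) ≠ 0 := by exact_mod_cast h₀.ne'
  have : (k n : ℝ) + m n = n := by exact_mod_cast hn
  field_simp
  linarith

theorem tendsto_sub_div_natCast_one (hkm : ∀ᶠ n in atTop, k n + m n = n)
    (hm : Tendsto (fun n : ℕ => (m n : ℝ) / √n) atTop (nhds t)) :
    Tendsto (fun n : ℕ => ((k n - m n : ℕ) : ℝ) / n) atTop (nhds 1) := by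
  have h := (tendsto_div_natCast_one hkm hm).sub (tendsto_div_natCast_zero hm)
  rw [sub_zero] at h
  refine h.congr' ?_
  filter_upwards [eventually_lt_of_tendsto hkm hm] with n hn
  rw [Nat.cast_sub hn.le, sub_div]

theorem tendsto_twoRatio (ht : 0 < t) (hkm : ∀ᶠ n in atTop, k n + m n = n)
    (hm : Tendsto (fun n : ℕ => (m n : ℝ) / √n) atTop (nhds t)) (j : ℕ) :
    Tendsto (fun n => twoRatio (k n) (m n) j) atTop
      (nhds ((2 / 3 * t ^ 2) ^ j / j.factorial)) := by
  have hl : (2 / 3 * t ^ 2) ^ j / j.factorial =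
      ∏ i ∈ range j, 2 / 3 * (t * t) / ((i + 1) * (1 + 0)) := by
    rw [← prod_range_add_one_eq_factorial, Nat.cast_prod, ← card_range j, ← prod_const,
      card_range, ← prod_div_distrib]
    refine prod_congr rfl fun i _ => ?_
    push_cast
    ring
  rw [hl]
  refine tendsto_finsetProd _ fun i _ => ?_
  have h₁ : Tendsto (fun n : ℕ => ((i : ℝ) + 1) / n) atTop (nhds 0) :=
    tendsto_const_div_atTop_nhds_zero_nat _
  have h₂ := tendsto_sub_div_sqrt ht hm (2 * i)
  have h₃ := tendsto_sub_div_sqrt ht hm (2 * i + 1)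
  have h₄ := ((tendsto_sub_div_natCast_one hkm hm).add h₁).const_mul ((i : ℝ) + 1)
  refine (((h₂.mul h₃).const_mul (2 / 3)).div h₄ (by positivity)).congr' ?_
  filter_upwards [eventually_gt_atTop 0] with n hn
  have hn' : (0 : ℝ) < n := by exact_mod_cast hn
  simp only [Pi.div_apply]
  rw [div_mul_div_comm, Real.mul_self_sqrt hn'.le, ← add_div, Nat.sub_sub]
  field_simp
  ring

theorem tendsto_tsum_twoRatio (ht : 0 < t) (hkm : ∀ᶠ n in atTop, k n + m n = n)
    (hm : Tendsto (fun n : ℕ => (m n : ℝ) / √n) atTop (nhds t)) :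
    Tendsto (fun n => ∑' j, twoRatio (k n) (m n) j) atTop
      (nhds (Real.exp (2 / 3 * t ^ 2))) := by
  rw [Real.exp_eq_exp_ℝ, NormedSpace.exp_eq_tsum_div]
  refine tendsto_tsum_of_dominated_convergence
    (bound := fun j => (2 / 3 * t ^ 2 + 1) ^ j / j.factorial)
    (Real.summable_pow_div_factorial _) (tendsto_twoRatio ht hkm hm) ?_
  have hM : Tendsto (fun n : ℕ => 2 / 3 * (m n : ℝ) ^ 2 / (k n - m n : ℕ)) atTop
      (nhds (2 / 3 * t ^ 2 / 1)) := by
    refine (((hm.pow 2).const_mul (2 / 3)).div (tendsto_sub_div_natCast_one hkm hm)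
      one_ne_zero).congr' ?_
    filter_upwards [eventually_gt_atTop 0] with n hn
    have hn' : (0 : ℝ) < n := by exact_mod_cast hn
    simp only [Pi.div_apply]
    rw [div_pow, Real.sq_sqrt hn'.le]
    field_simp
  filter_upwards [eventually_lt_of_tendsto hkm hm,
    hM.eventually_le_const (show 2 / 3 * t ^ 2 / 1 < 2 / 3 * t ^ 2 + 1 by linarith)]
    with n hn hle j
  rw [Real.norm_of_nonneg (twoRatio_nonneg _ _ _)]
  refine (twoRatio_le hn j).trans ?_
  gcongr

theorem tendsto_mul_div_sub_pow_three (hkm : ∀ᶠ n in atTop, k n + m n = n)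
    (hm : Tendsto (fun n : ℕ => (m n : ℝ) / √n) atTop (nhds t)) :
    Tendsto (fun n => (k n : ℝ) * (2 * m n / ((k n - m n : ℕ) : ℝ)) ^ 3) atTop (nhds 0) := by
  have h := (((tendsto_div_natCast_one hkm hm).mul
    (((hm.const_mul 2).div (tendsto_sub_div_natCast_one hkm hm) one_ne_zero).pow 3))).mul
    tendsto_inv_sqrt_natCast
  rw [mul_zero] at h
  refine h.congr' ?_
  filter_upwards [eventually_gt_atTop 0] with n hn
  have hn' : (0 : ℝ) < n := by exact_mod_cast hn
  have hs : (0 : ℝ) < √n := Real.sqrt_pos.2 hn'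
  have hss : (√n : ℝ) ^ 4 = n ^ 2 := by
    rw [show 4 = 2 * 2 by rfl, pow_mul, Real.sq_sqrt hn'.le]
  simp only [Pi.div_apply]
  rcases eq_or_ne ((k n - m n : ℕ) : ℝ) 0 with h₀ | h₀
  · simp [h₀]
  · field_simp
    rw [hss]
    ring

theorem tendsto_excessWeight_exists_three_le_div (hk : ∀ n, 0 < k n)
    (hkm : ∀ᶠ n in atTop, k n + m n = n)
    (hm : Tendsto (fun n : ℕ => (m n : ℝ) / √n) atTop (nhds t)) :
    Tendsto (fun n => excessWeight (k n) (m n) (fun a => ∃ i, 3 ≤ a i) /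
      excessWeight (k n) (m n) fun _ => True) atTop (nhds 0) := by
  refine tendsto_of_tendsto_of_tendsto_of_le_of_le' tendsto_const_nhds
    (tendsto_mul_div_sub_pow_three hkm hm)
    (Eventually.of_forall fun n => div_nonneg (excessWeight_nonneg _) (excessWeight_nonneg _)) ?_
  filter_upwards [eventually_lt_of_tendsto hkm hm] with n hn
  rw [div_le_iff₀ (excessWeight_true_pos (hk n) _)]
  exact excessWeight_exists_three_le_le_mul hn

theorem tendsto_excessWeight_forall_le_two_div (hk : ∀ n, 0 < k n)
    (hkm : ∀ᶠ n in atTop, k n + m n = n)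
    (hm : Tendsto (fun n : ℕ => (m n : ℝ) / √n) atTop (nhds t)) :
    Tendsto (fun n => excessWeight (k n) (m n) (fun a => ∀ i, a i ≤ 2) /
      excessWeight (k n) (m n) fun _ => True) atTop (nhds 1) := by
  have h := (tendsto_excessWeight_exists_three_le_div hk hkm hm).const_sub 1
  rw [sub_zero] at h
  refine h.congr fun n => ?_
  have h₁ := excessWeight_true_pos (hk n) (m n)
  have h₂ := excessWeight_add_not (k := k n) (m := m n) fun a => ∀ i, a i ≤ 2
  have h₃ : (fun a : Fin (k n) → ℕ => ¬ ∀ i, a i ≤ 2) = fun a => ∃ i, 3 ≤ a i := by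
    ext a
    push Not
    rfl
  rw [h₃] at h₂
  rw [one_sub_div h₁.ne', ← h₂, add_sub_cancel_right]

theorem tendsto_excessWeight_card_two_div (ht : 0 < t) (hk : ∀ n, 0 < k n)
    (hkm : ∀ᶠ n in atTop, k n + m n = n)
    (hm : Tendsto (fun n : ℕ => (m n : ℝ) / √n) atTop (nhds t)) (j : ℕ) :
    Tendsto (fun n => excessWeight (k n) (m n)
        (fun a => (∀ i, a i ≤ 2) ∧ #{i | a i = 2} = j) /
      excessWeight (k n) (m n) fun _ => True) atTop
      (nhds (Real.exp (-(2 / 3 * t ^ 2)) * (2 / 3 * t ^ 2) ^ j / j.factorial)) := by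
  have hS := tendsto_tsum_twoRatio ht hkm hm
  have h := ((tendsto_excessWeight_forall_le_two_div hk hkm hm).div hS
    (Real.exp_pos _).ne').mul (tendsto_twoRatio ht hkm hm j)
  rw [one_div, ← Real.exp_neg, ← mul_div_assoc] at h
  refine h.congr' ?_
  filter_upwards [eventually_lt_of_tendsto hkm hm, hS.eventually_ne (Real.exp_pos _).ne']
    with n hn hne
  simp only [Pi.div_apply]
  rw [excessWeight_card_two_eq hn.le, excessWeight_forall_le_two hn.le]
  field_simp

theorem tendsto_excessWeight_card_eq_two_div (ht : 0 < t) (hk : ∀ n, 0 < k n)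
    (hkm : ∀ᶠ n in atTop, k n + m n = n)
    (hm : Tendsto (fun n : ℕ => (m n : ℝ) / √n) atTop (nhds t)) (j : ℕ) :
    Tendsto (fun n => excessWeight (k n) (m n) (fun a => #{i | a i = 2} = j) /
      excessWeight (k n) (m n) fun _ => True) atTop
      (nhds (Real.exp (-(2 / 3 * t ^ 2)) * (2 / 3 * t ^ 2) ^ j / j.factorial)) := by
  have h := tendsto_excessWeight_card_two_div ht hk hkm hm j
  have h' := h.add (tendsto_excessWeight_exists_three_le_div hk hkm hm)
  rw [add_zero] at h'
  refine tendsto_of_tendsto_of_tendsto_of_le_of_le h h' (fun n => ?_) fun n => ?_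
  · exact div_le_div_of_nonneg_right (excessWeight_mono fun a ha => ha.2) (excessWeight_nonneg _)
  · simp only []
    rw [← add_div]
    refine div_le_div_of_nonneg_right (le_trans (excessWeight_mono fun a ha => ?_)
      (excessWeight_or_le _ _)) (excessWeight_nonneg _)
    by_cases h2 : ∀ i, a i ≤ 2
    · exact Or.inl ⟨h2, ha⟩
    · push Not at h2
      exact Or.inr h2

end Asymptotics

/-- let `t > 0` and `k(n)` be an increasing sequence of positive integers with
`(n − k(n))/√n → t`, and let `D_i` be the number of blocks of size `i` in a uniformly random
set partition of `{1,…,n}` into exactly `k(n)` blocks. Then `D_3` converges in distribution to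
Poisson with mean `(2/3)t²` (pointwise convergence of the probability mass function), and
with high probability all other blocks have size one or two:
`P(D_i = 0 for all i ≥ 4) → 1`. -/
theorem set_partition_small_blocks (t : ℝ) (ht : 0 < t) (k : ℕ → ℕ)
    (hmono : Monotone k) (hpos : ∀ n, 0 < k n)
    (hlim : Tendsto (fun n : ℕ => ((n - k n : ℕ) : ℝ) / Real.sqrt n) atTop (nhds t)) :
    (∀ j : ℕ, Tendsto (fun n : ℕ => partProb n (k n) (fun P => blockCount P 3 = j))
        atTop (nhds (ProbabilityTheory.poissonPMFReal (Real.toNNReal ((2/3) * t ^ 2)) j))) ∧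
    Tendsto (fun n : ℕ => partProb n (k n) (fun P => ∀ i, 4 ≤ i → blockCount P i = 0))
        atTop (nhds 1) := by
  have hkn : ∀ᶠ n in atTop, k n ≤ n := by
    filter_upwards [hlim.eventually_const_lt ht] with n hn
    by_contra! h
    simp [Nat.sub_eq_zero_of_le h.le] at hn
  have hkm : ∀ᶠ n in atTop, k n + (n - k n) = n := hkn.mono fun n hn => Nat.add_sub_cancel' hn
  constructor
  · intro j
    have hl : ProbabilityTheory.poissonPMFReal (Real.toNNReal ((2 / 3) * t ^ 2)) j =
        Real.exp (-(2 / 3 * t ^ 2)) * (2 / 3 * t ^ 2) ^ j / j.factorial := by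
      rw [ProbabilityTheory.poissonPMFReal, Real.coe_toNNReal _ (by positivity)]
    rw [hl]
    refine (tendsto_excessWeight_card_eq_two_div ht hpos hkm hlim j).congr' ?_
    filter_upwards [hkn] with n hn
    refine (partProb_eq_excessWeight_div hn fun P e => ?_).symm
    rw [card_filter_equiv_parts]
  · refine (tendsto_excessWeight_forall_le_two_div hpos hkm hlim).congr' ?_
    filter_upwards [hkn] with n hn
    refine (partProb_eq_excessWeight_div hn fun P e => ?_).symm
    constructor
    · intro h j
      by_contra! hj
      have h₁ := h (#(e.symm j).1 - 1 + 1) (by omega)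
      rw [← card_filter_equiv_parts P e, card_eq_zero] at h₁
      exact notMem_empty j (h₁ ▸ (mem_filter_univ j).2 rfl)
    · intro h i hi
      obtain ⟨i, rfl⟩ := Nat.exists_eq_add_of_le' (show 1 ≤ i by omega)
      rw [← card_filter_equiv_parts P e, card_eq_zero, filter_eq_empty_iff]
      intro j _
      have : #(e.symm j).1 - 1 ≤ 2 := h j
      omega
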